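/- Let m be a positive integer and s a complex number with Re s > 1/2. Then Σ_{C ≥ 1, C odd} g(χ₄; 32C; m)/(32C)^{2s} equals (8/32^{2s})·τ(χ₄)·(m/8)^{1−2s}·σ_{2s−1}(χ₄; m/8)/L(χ₄, 2s) if 8 divides m but 16 does not divide m, and equals 0 otherwise. Here g(χ₄; q; m) := Σ_{u mod q, gcd(u,q)=1} χ₄(u)·e(m·u/q) and τ(χ₄) := g(χ₄;4;1) = 2i. -/

import Mathlib

open Complex Real MeasureTheory Filter Finset

noncomputable section

/-- The nontrivial Dirichlet character mod 4, extended to `ℤ`, valued in `ℂ`. -/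
def chi4 (m : ℤ) : ℂ := if m % 4 = 1 then 1 else if m % 4 = 3 then -1 else 0

/-- `σ_s(χ₄; n) = ∑_{d ∣ n} χ₄(d) d^s`. -/
def sigmaChi4 (s : ℂ) (n : ℕ) : ℂ := ∑ d ∈ n.divisors, chi4 d * (d : ℂ) ^ s

/-- `σ'_s(χ₄; n) = ∑_{d ∣ n} χ₄(d) d^s log d`. -/
def sigmaChi4' (s : ℂ) (n : ℕ) : ℂ := ∑ d ∈ n.divisors, chi4 d * (d : ℂ) ^ s * (Real.log d : ℂ)

/-- `e(x) = exp(2πix)`. -/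
def e2pi (x : ℂ) : ℂ := Complex.exp (2 * (Real.pi : ℂ) * Complex.I * x)

/-- The Dirichlet L-function of the nontrivial character mod 4. -/
def Lchi4 (s : ℂ) : ℂ :=
  DirichletCharacter.LFunction (ZMod.χ₄.ringHomComp (Int.castRingHom ℂ)) s

/-- Generalized quadratic Gauss sum `G(a, n; q)`. -/
def Gsum (a n : ℤ) (q : ℕ) : ℂ :=
  ∑ x ∈ Finset.range q, e2pi (((a * (x : ℤ) ^ 2 + n * (x : ℤ) : ℤ) : ℂ) / (q : ℂ))

/-- `K(n, l; q) = ∑_{a b ≡ 1 (mod q)} G(a,n;q) G(b,l;q)`. -/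
def Ksum (n l : ℤ) (q : ℕ) : ℂ :=
  ∑ a ∈ Finset.range q, ∑ b ∈ Finset.range q,
    if (a * b) % q = 1 % q then Gsum a n q * Gsum b l q else 0

/-- Kloosterman sum `S(m, n; c)`. -/
def kloosterman (m n : ℤ) (c : ℕ) : ℂ :=
  ∑ x ∈ Finset.range c,
    if Nat.gcd x c = 1 then
      e2pi (((m * (x : ℤ) + n * ((((x : ZMod c)⁻¹).val : ℕ) : ℤ) : ℤ) : ℂ) / (c : ℂ))
    else 0

/-- Ramanujan sum `c_C(m)`. -/
def ramanujanSum (C : ℕ) (m : ℤ) : ℂ :=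
  ∑ D ∈ Finset.range C,
    if Nat.gcd D C = 1 then e2pi (((m * (D : ℤ) : ℤ) : ℂ) / (C : ℂ)) else 0

/-- Gauss sum `g(χ₄; q; m)`. -/
def gaussChi4 (q : ℕ) (m : ℤ) : ℂ :=
  ∑ u ∈ Finset.range q,
    if Nat.gcd u q = 1 then chi4 u * e2pi (((m * (u : ℤ) : ℤ) : ℂ) / (q : ℂ)) else 0

end

local notation "chiD" => (ZMod.χ₄.ringHomComp (Int.castRingHom ℂ))

lemma chi4_eq (n : ℕ) : chi4 (n : ℤ) = chiD (n : ZMod 4) := by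
  have h := ZMod.χ₄_nat_eq_if_mod_four n
  rw [MulChar.ringHomComp_apply, h]
  unfold chi4
  have h4 : n % 4 < 4 := Nat.mod_lt _ (by norm_num)
  split_ifs <;> first | (exfalso; omega) | simp

lemma chi4_mul (a b : ℕ) : chi4 ((a * b : ℕ) : ℤ) = chi4 (a : ℤ) * chi4 (b : ℤ) := by
  rw [chi4_eq, chi4_eq, chi4_eq, Nat.cast_mul, map_mul]

lemma chi4_even {n : ℕ} (h : ¬ Odd n) : chi4 (n : ℤ) = 0 := by
  rw [Nat.not_odd_iff] at h
  unfold chi4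
  split_ifs <;> first | (exfalso; omega) | rfl

/-- the summand -/
noncomputable def Fsum (m N u : ℕ) : ℂ := chi4 (u : ℤ) * e2pi (((m * (u : ℤ) : ℤ) : ℂ) / (N : ℂ))

lemma gauss_piece (m k d : ℕ) (hk : 0 < k) (hd : 0 < d) :
    chi4 (k : ℤ) * gaussChi4 (32 * d) (m : ℤ) =
      ∑ u ∈ (range (32 * (k * d))).filter (fun u => Nat.gcd u (32 * (k * d)) = k),
        Fsum m (32 * (k * d)) u := by
  unfold gaussChi4
  rw [← Finset.sum_filter, Finset.mul_sum]
  have e : 32 * (k * d) = k * (32 * d) := by ring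
  refine Finset.sum_nbij' (fun v => k * v) (fun u => u / k) ?_ ?_ ?_ ?_ ?_
  · intro v hv
    simp only [mem_filter, mem_range] at hv ⊢
    refine ⟨?_, ?_⟩
    · rw [e]; exact Nat.mul_lt_mul_of_pos_left hv.1 hk
    · rw [e, Nat.gcd_mul_left, hv.2, mul_one]
  · intro u hu
    simp only [mem_filter, mem_range] at hu ⊢
    obtain ⟨h1, h2⟩ := hu
    obtain ⟨v, rfl⟩ : k ∣ u := by rw [← h2]; exact Nat.gcd_dvd_left _ _
    rw [e] at h1 h2
    rw [Nat.mul_div_cancel_left _ hk]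
    refine ⟨Nat.lt_of_mul_lt_mul_left h1, ?_⟩
    rw [Nat.gcd_mul_left] at h2
    exact Nat.eq_of_mul_eq_mul_left hk (by rw [h2, mul_one])
  · intro v hv
    exact Nat.mul_div_cancel_left _ hk
  · intro u hu
    simp only [mem_filter, mem_range] at hu
    refine Nat.mul_div_cancel' ?_
    rw [← hu.2]; exact Nat.gcd_dvd_left _ _
  · intro v hv
    unfold Fsum
    rw [chi4_mul, mul_assoc]
    congr 3
    have hk' : (k : ℂ) ≠ 0 := by exact_mod_cast hk.ne'
    have hd' : (d : ℂ) ≠ 0 := by exact_mod_cast hd.ne'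
    push_cast
    field_simp

lemma gauss_conv (m C : ℕ) (hC : 0 < C) (hodd : Odd C) :
    ∑ p ∈ C.divisorsAntidiagonal, chi4 (p.1 : ℤ) * gaussChi4 (32 * p.2) (m : ℤ) =
      ∑ u ∈ range (32 * C), Fsum m (32 * C) u := by
  have h1 : ∑ u ∈ range (32 * C), Fsum m (32 * C) u =
      ∑ u ∈ (range (32 * C)).filter (fun u => Nat.gcd u (32 * C) ∈ C.divisors),
        Fsum m (32 * C) u := by
    symm
    apply Finset.sum_filter_of_ne
    intro u hu hne
    have hu2 : Odd u := by
      by_contra h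
      exact hne (by simp [Fsum, chi4_even h])
    have hc : Nat.Coprime u 32 := by
      have : Nat.Coprime u (2 ^ 5) := Nat.Coprime.pow_right 5 (Nat.coprime_two_right.mpr hu2)
      simpa using this
    rw [Nat.Coprime.gcd_mul_left_cancel_right _ hc.symm]
    exact Nat.mem_divisors.mpr ⟨Nat.gcd_dvd_right _ _, hC.ne'⟩
  rw [h1, Nat.sum_divisorsAntidiagonal (fun a b => chi4 (a : ℤ) * gaussChi4 (32 * b) (m : ℤ)),
    ← Finset.sum_fiberwise_of_maps_to (s := (range (32 * C)).filter _) (t := C.divisors)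
      (g := fun u => Nat.gcd u (32 * C)) (fun u hu => (mem_filter.mp hu).2)]
  refine Finset.sum_congr rfl fun k hk => ?_
  have hk' := hk
  obtain ⟨d, rfl⟩ := Nat.dvd_of_mem_divisors hk
  have hk0 : 0 < k := Nat.pos_of_mul_pos_right hC
  have hd0 : 0 < d := Nat.pos_of_mul_pos_left hC
  rw [Nat.mul_div_cancel_left _ hk0, gauss_piece m k d hk0 hd0, Finset.filter_filter]
  refine Finset.sum_congr ?_ fun _ _ => rfl
  ext u
  simp only [mem_filter, mem_range]
  constructor
  · rintro ⟨a, b⟩; exact ⟨a, by rw [b]; exact hk', b⟩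
  · rintro ⟨a, _, b⟩; exact ⟨a, b⟩

lemma sum_range_four (f : ℕ → ℂ) (N : ℕ) : ∑ u ∈ range (4 * N), f u =
    ∑ k ∈ range N, (f (4 * k) + f (4 * k + 1) + f (4 * k + 2) + f (4 * k + 3)) := by
  induction N with
  | zero => simp
  | succ n ih =>
    rw [show 4 * (n + 1) = 4 * n + 1 + 1 + 1 + 1 by ring, sum_range_succ, sum_range_succ,
      sum_range_succ, sum_range_succ, sum_range_succ, ih]
    ring

lemma e2pi_add (x y : ℂ) : e2pi (x + y) = e2pi x * e2pi y := by
  unfold e2pi; rw [mul_add, Complex.exp_add]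

lemma e2pi_nat_mul (n : ℕ) (x : ℂ) : e2pi (n * x) = e2pi x ^ n := by
  unfold e2pi; rw [← Complex.exp_nat_mul]; congr 1; ring

lemma e2pi_quarter : e2pi (1 / 4) = Complex.I := by
  unfold e2pi
  rw [show 2 * (Real.pi : ℂ) * Complex.I * (1 / 4) = (Real.pi : ℂ) / 2 * Complex.I by ring]
  exact Complex.exp_pi_div_two_mul_I

lemma e2pi_one : e2pi 1 = 1 := by
  unfold e2pi; rw [mul_one, Complex.exp_two_pi_mul_I]

lemma e2pi_frac_eq_one (m N : ℕ) (hN : 0 < N) (h : e2pi ((m : ℂ) / N) = 1) : N ∣ m := by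
  unfold e2pi at h
  rw [Complex.exp_eq_one_iff] at h
  obtain ⟨n, hn⟩ := h
  have hN' : (N : ℂ) ≠ 0 := by exact_mod_cast hN.ne'
  have hp : (2 * (Real.pi : ℂ) * Complex.I) ≠ 0 := Complex.two_pi_I_ne_zero
  have : (m : ℂ) / N = n := mul_left_cancel₀ hp (by rw [hn]; ring)
  rw [div_eq_iff hN'] at this
  have h2 : (m : ℤ) = n * N := by exact_mod_cast this
  exact Int.natCast_dvd_natCast.mp ⟨n, by rw [h2]; ring⟩

lemma I_pow_sub (j : ℕ) : Complex.I ^ j - (Complex.I ^ 3) ^ j = 2 * Complex.I * chi4 (j : ℤ) := by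
  obtain ⟨q, r, hr, rfl⟩ : ∃ q r, r < 4 ∧ j = 4 * q + r :=
    ⟨j / 4, j % 4, Nat.mod_lt _ (by norm_num), by omega⟩
  have h4 : Complex.I ^ 4 = 1 := Complex.I_pow_four
  have hc : chi4 ((4 * q + r : ℕ) : ℤ) = chi4 (r : ℤ) := by
    rw [chi4_eq, chi4_eq]; congr 1; push_cast
    rw [show (4 : ZMod 4) = 0 from rfl]; ring
  have h43 : (Complex.I ^ 3) ^ 4 = 1 := by rw [← pow_mul, mul_comm, pow_mul, h4, one_pow]
  rw [hc, pow_add, pow_add, pow_mul, pow_mul, h4, h43, one_pow, one_mul, one_mul]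
  interval_cases r
  · simp [chi4]
  · simp [chi4, Complex.I_pow_three]; ring
  · simp [chi4, Complex.I_pow_three]
  · simp only [Complex.I_pow_three]
    rw [show (-Complex.I) ^ 3 = - Complex.I ^ 3 by ring, Complex.I_pow_three]
    simp [chi4]; ring

lemma Fsum_total (m N : ℕ) (hN : 0 < N) :
    ∑ u ∈ range (4 * N), Fsum m (4 * N) u =
      if N ∣ m then N * (2 * Complex.I * chi4 ((m / N : ℕ) : ℤ)) else 0 := by
  have hN' : (N : ℂ) ≠ 0 := by exact_mod_cast hN.ne'
  rw [sum_range_four]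
  have hk : ∀ k, Fsum m (4 * N) (4 * k) + Fsum m (4 * N) (4 * k + 1) + Fsum m (4 * N) (4 * k + 2)
      + Fsum m (4 * N) (4 * k + 3) = e2pi ((m : ℂ) / N) ^ k *
        (e2pi ((m : ℂ) / (4 * N)) - e2pi ((m : ℂ) / (4 * N)) ^ 3) := by
    intro k
    have c0 : chi4 ((4 * k : ℕ) : ℤ) = 0 := by
      unfold chi4; split_ifs <;> first | (exfalso; omega) | rfl
    have c1 : chi4 ((4 * k + 1 : ℕ) : ℤ) = 1 := by
      unfold chi4; split_ifs <;> first | (exfalso; omega) | rfl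
    have c2 : chi4 ((4 * k + 2 : ℕ) : ℤ) = 0 := by
      unfold chi4; split_ifs <;> first | (exfalso; omega) | rfl
    have c3 : chi4 ((4 * k + 3 : ℕ) : ℤ) = -1 := by
      unfold chi4; split_ifs <;> first | (exfalso; omega) | rfl
    unfold Fsum
    rw [c0, c1, c2, c3, ← e2pi_nat_mul, ← e2pi_nat_mul, mul_sub, ← e2pi_add, ← e2pi_add]
    simp only [zero_mul, zero_add, add_zero, one_mul, neg_mul]
    rw [← sub_eq_add_neg]
    congr 2 <;> (push_cast; field_simp)
  simp only [hk]
  rw [← Finset.sum_mul]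
  split_ifs with h
  · obtain ⟨j, rfl⟩ := h
    rw [Nat.mul_div_cancel_left _ hN]
    have e1 : e2pi (((N * j : ℕ) : ℂ) / N) = 1 := by
      rw [show (((N * j : ℕ) : ℂ) / N) = j * 1 by push_cast; field_simp, e2pi_nat_mul, e2pi_one,
        one_pow]
    have e2 : e2pi (((N * j : ℕ) : ℂ) / (4 * N)) = Complex.I ^ j := by
      rw [show (((N * j : ℕ) : ℂ) / (4 * N)) = j * (1 / 4) by push_cast; field_simp, e2pi_nat_mul,
        e2pi_quarter]
    rw [e1, e2, ← I_pow_sub, ← pow_mul, ← pow_mul, mul_comm 3 j]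
    simp
  · have hz : e2pi ((m : ℂ) / N) ≠ 1 := fun h' => h (e2pi_frac_eq_one m N hN h')
    rw [geom_sum_eq hz, ← e2pi_nat_mul, show (N : ℂ) * (m / N) = m * 1 by field_simp, e2pi_nat_mul,
      e2pi_one, one_pow, sub_self, zero_div, zero_mul]

/-- The coefficients. -/
noncomputable def Gfun (m : ℕ) (C : ℕ) : ℂ := if Odd C then gaussChi4 (32 * C) (m : ℤ) else 0

/-- The convolution of the coefficients with the character. -/
noncomputable def Hfun (m : ℕ) (C : ℕ) : ℂ :=
  if Odd C ∧ 8 * C ∣ m then 16 * Complex.I * C * chi4 ((m / (8 * C) : ℕ) : ℤ) else 0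

open scoped LSeries.notation in
lemma conv_eq (m : ℕ) : (fun n : ℕ => chiD (n : ZMod 4)) ⍟ Gfun m = Hfun m := by
  rw [LSeries.convolution_def]
  funext C
  rcases Nat.eq_zero_or_pos C with rfl | hC
  · simp [Hfun]
  by_cases ho : Odd C
  · have : ∀ p ∈ C.divisorsAntidiagonal, chiD ((p.1 : ℕ) : ZMod 4) * Gfun m p.2 =
        chi4 (p.1 : ℤ) * gaussChi4 (32 * p.2) (m : ℤ) := by
      intro p hp
      have hp' := (Nat.mem_divisorsAntidiagonal.mp hp).1
      have : Odd p.2 := by rw [← hp'] at ho; exact (Nat.odd_mul.mp ho).2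
      rw [← chi4_eq, Gfun, if_pos this]
    rw [Finset.sum_congr rfl this, gauss_conv m C hC ho, show 32 * C = 4 * (8 * C) by ring,
      Fsum_total m (8 * C) (by omega), Hfun]
    simp only [ho, true_and]
    split_ifs
    · push_cast; ring
    · rfl
  · rw [Hfun, if_neg (fun h => ho h.1)]
    apply Finset.sum_eq_zero
    intro p hp
    have hp' := (Nat.mem_divisorsAntidiagonal.mp hp).1
    rw [← chi4_eq]
    by_cases h2 : Odd p.2
    · have : ¬ Odd p.1 := fun h1 => ho (by rw [← hp']; exact Nat.odd_mul.mpr ⟨h1, h2⟩)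
      rw [chi4_even this, zero_mul]
    · rw [Gfun, if_neg h2, mul_zero]

lemma Hfun_zero {m : ℕ} (hm : 0 < m) {C : ℕ} (hC : C ∉ range (m + 1)) : Hfun m C = 0 := by
  rw [Hfun, if_neg]
  rintro ⟨_, h⟩
  have := Nat.le_of_dvd hm h
  simp at hC; omega

lemma Hfun_term_zero {m : ℕ} (hm : 0 < m) (z : ℂ) {C : ℕ} (hC : C ∉ range (m + 1)) :
    LSeries.term (Hfun m) z C = 0 := by
  rw [LSeries.term_def, Hfun_zero hm hC]; simp

lemma Hfun_summable {m : ℕ} (hm : 0 < m) (z : ℂ) : LSeriesSummable (Hfun m) z :=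
  summable_of_ne_finset_zero (s := range (m + 1)) fun _ hC => Hfun_term_zero hm z hC

open scoped LSeries.notation ArithmeticFunction.Moebius in
lemma Gfun_eq (m : ℕ) : Gfun m =
    ((fun n : ℕ => chiD (n : ZMod 4)) * (fun n : ℕ => ((ArithmeticFunction.moebius n : ℤ) : ℂ)))
      ⍟ Hfun m := by
  have h := DirichletCharacter.convolution_mul_moebius (chiD : DirichletCharacter ℂ 4)
  have h0 : Gfun m 0 = 0 := by simp [Gfun]
  have h1 : toArithmeticFunction (LSeries.delta) = (1 : ArithmeticFunction ℂ) := by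
    rw [← ArithmeticFunction.one_eq_delta, ArithmeticFunction.toArithmeticFunction_eq_self]
  have key : ∀ f g : ℕ → ℂ, toArithmeticFunction (f ⍟ g) =
      toArithmeticFunction f * toArithmeticFunction g := by
    intro f g
    rw [LSeries.convolution, ArithmeticFunction.toArithmeticFunction_eq_self]
  have h' := congrArg toArithmeticFunction h
  rw [key, h1] at h'
  rw [← conv_eq]
  conv_rhs => rw [LSeries.convolution, key, ← mul_assoc, mul_comm (toArithmeticFunction _)
    (toArithmeticFunction _), h', one_mul]
  funext n
  show _ = if n = 0 then 0 else Gfun m n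
  split_ifs with hn
  · rw [hn, h0]
  · rfl

lemma Gfun_summable {m : ℕ} (hm : 0 < m) {z : ℂ} (hz : 1 < z.re) : LSeriesSummable (Gfun m) z := by
  rw [Gfun_eq]
  apply LSeriesSummable.convolution _ (Hfun_summable hm z)
  exact DirichletCharacter.LSeriesSummable_mul (chiD : DirichletCharacter ℂ 4)
    (ArithmeticFunction.LSeriesSummable_moebius_iff.mpr hz)

lemma LSeries_Gfun {m : ℕ} (hm : 0 < m) {z : ℂ} (hz : 1 < z.re) :
    LSeries (Gfun m) z = LSeries (Hfun m) z / Lchi4 z := by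
  have h1 := DirichletCharacter.LSeriesSummable_of_one_lt_re (chiD : DirichletCharacter ℂ 4) hz
  have h2 := DirichletCharacter.LSeries_ne_zero_of_one_lt_re (chiD : DirichletCharacter ℂ 4) hz
  have h3 := LSeries_convolution' h1 (Gfun_summable hm hz)
  rw [conv_eq] at h3
  rw [Lchi4, DirichletCharacter.LFunction_eq_LSeries _ hz, h3, mul_div_cancel_left₀ _ h2]

lemma LSeries_Hfun {m : ℕ} (hm : 0 < m) (z : ℂ) :
    LSeries (Hfun m) z = if 8 ∣ m ∧ ¬ (16 ∣ m) then
      16 * Complex.I * (((m / 8 : ℕ) : ℂ) ^ (1 - z) * sigmaChi4 (z - 1) (m / 8)) else 0 := by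
  split_ifs with h
  · obtain ⟨⟨n, rfl⟩, h16⟩ := h
    have hn : 0 < n := by omega
    have hno : Odd n := by
      by_contra hh
      obtain ⟨k, rfl⟩ := Nat.not_odd_iff_even.mp hh
      exact h16 ⟨k, by ring⟩
    rw [Nat.mul_div_cancel_left _ (by norm_num : 0 < 8)]
    have e1 : LSeries (Hfun (8 * n)) z = ∑ C ∈ n.divisors, LSeries.term (Hfun (8 * n)) z C := by
      apply tsum_eq_sum
      intro C hC
      have hH : Hfun (8 * n) C = 0 := by
        rw [Hfun, if_neg]
        rintro ⟨_, hd⟩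
        exact hC (Nat.mem_divisors.mpr ⟨Nat.dvd_of_mul_dvd_mul_left (by norm_num) hd, hn.ne'⟩)
      rw [LSeries.term_def, hH]; simp
    rw [e1, sigmaChi4, Finset.mul_sum, Finset.mul_sum, ← Nat.sum_div_divisors]
    refine Finset.sum_congr rfl fun d hd => ?_
    obtain ⟨c, rfl⟩ := Nat.dvd_of_mem_divisors hd
    have hd0 : 0 < d := Nat.pos_of_mul_pos_right hn
    have hc0 : 0 < c := Nat.pos_of_mul_pos_left hn
    have hdC : (d : ℂ) ≠ 0 := by exact_mod_cast hd0.ne'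
    have hcC : (c : ℂ) ≠ 0 := by exact_mod_cast hc0.ne'
    rw [Nat.mul_div_cancel_left _ hd0, LSeries.term_of_ne_zero hc0.ne', Hfun,
      if_pos ⟨(Nat.odd_mul.mp hno).2, ⟨d, by ring⟩⟩,
      show 8 * (d * c) / (8 * c) = d by
        rw [show 8 * (d * c) = 8 * c * d by ring]; exact Nat.mul_div_cancel_left _ (by omega),
      Nat.cast_mul, Complex.natCast_mul_natCast_cpow, show z - 1 = -(1 - z) by ring,
      Complex.cpow_neg, Complex.cpow_sub _ _ hcC, Complex.cpow_one]
    have : (d : ℂ) ^ (1 - z) ≠ 0 := by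
      rw [Ne, Complex.cpow_eq_zero_iff]; exact fun h => hdC h.1
    field_simp
  · have : LSeries (Hfun m) z = LSeries (fun _ => 0) z := by
      apply LSeries_congr
      intro C hC
      rw [Hfun]
      split_ifs with hh
      · obtain ⟨ho, k, rfl⟩ := hh
        have hC' : 0 < 8 * C := by omega
        rw [Nat.mul_div_cancel_left _ hC']
        have : ¬ Odd k := by
          intro hk
          apply h
          refine ⟨⟨C * k, by ring⟩, ?_⟩
          rintro ⟨j, hj⟩
          have h3 : C * k = 2 * j := by nlinarith
          have h4 := Nat.odd_mul.mpr ⟨ho, hk⟩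
          rw [h3] at h4
          exact absurd h4 (by simp)
        rw [chi4_even this, mul_zero]
      · rfl
    rw [this]
    simp [LSeries, LSeries.term_def]

/-- Dirichlet series of the Gauss sums `g(χ₄; 32C; m)` over odd `C`. -/
theorem tsum_gaussChi4_32_odd (m : ℕ) (hm : 0 < m) (s : ℂ) (hs : 1 / 2 < s.re) :
    ∑' C : ℕ+, (if Odd (C : ℕ) then
        gaussChi4 (32 * (C : ℕ)) (m : ℤ) / ((32 * (C : ℕ) : ℕ) : ℂ) ^ (2 * s)
      else 0) =
      if 8 ∣ m ∧ ¬ (16 ∣ m) then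
        (8 / (32 : ℂ) ^ (2 * s)) * (2 * Complex.I) *
          ((m / 8 : ℕ) : ℂ) ^ (1 - 2 * s) * sigmaChi4 (2 * s - 1) (m / 8) / Lchi4 (2 * s)
      else 0 := by
  have hz : 1 < (2 * s).re := by
    simp; linarith
  have h1 : ∀ C : ℕ+, (if Odd (C : ℕ) then
        gaussChi4 (32 * (C : ℕ)) (m : ℤ) / ((32 * (C : ℕ) : ℕ) : ℂ) ^ (2 * s)
      else 0) = ((32 : ℂ) ^ (2 * s))⁻¹ * LSeries.term (Gfun m) (2 * s) C := by
    intro C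
    rw [LSeries.term_of_ne_zero C.pos.ne', Gfun]
    split_ifs
    · rw [Nat.cast_mul, Complex.natCast_mul_natCast_cpow]
      push_cast
      rw [div_eq_mul_inv, mul_inv]
      ring
    · simp
  rw [tsum_congr h1, tsum_mul_left]
  have h2 : ∑' C : ℕ+, LSeries.term (Gfun m) (2 * s) C = LSeries (Gfun m) (2 * s) := by
    rw [LSeries]
    exact tsum_pnat_eq_tsum_of_eq_zero (by simp)
  rw [h2, LSeries_Gfun hm hz, LSeries_Hfun hm]
  split_ifs
  · ring
  · simp
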